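/- Let 𝒢 be an isomorphism-closed class of finite connected simple graphs and let sep : ℕ → ℕ be monotone non-decreasing with sep(n) ≤ ρ·√n for all n, for some constant ρ > 0. Suppose that every n-vertex graph G ∈ 𝒢 admits a (1/2)-balanced in-class separator of size at most sep(n). Then there exist constants s ∈ ℕ and K > 0 (depending only on ρ) such that for every n-vertex graph G ∈ 𝒢 and every integer r with s < r < n, there exists a family 𝒫 of subsets of V(G) satisfying: (i) ⋃_{P∈𝒫} P = V(G); (ii) |P| ≤ r for every P ∈ 𝒫; (iii) |𝒫| ≤ K·n/r; (iv) the boundary ∂(𝒫), consisting of the vertices that lie in at least two distinct sets of 𝒫, satisfies |∂(𝒫)| ≤ K·n/√r; and (v) the induced subgraph G[P] belongs to 𝒢 for every P ∈ 𝒫. -/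

import Mathlib

open SimpleGraph

/-- The union of the vertex sets of a collection `X` of connected components of `G − Z`
(the subgraph of `G` induced on the complement of `Z`). -/
def compUnion {V : Type} (G : SimpleGraph V) (Z : Set V)
    (X : Set ((G.induce (Zᶜ : Set V)).ConnectedComponent)) : Set V :=
  {v | ∃ h : v ∈ (Zᶜ : Set V), (G.induce (Zᶜ : Set V)).connectedComponentMk ⟨v, h⟩ ∈ X}

/-- `Z` is an `α`-balanced separator of `G`: every connected component of `G − Z` has at most
`(1 − α) · |V(G)|` vertices. -/
def IsBalSep {V : Type} (G : SimpleGraph V) (α : ℝ) (Z : Set V) : Prop :=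
  ∀ C : (G.induce (Zᶜ : Set V)).ConnectedComponent,
    (C.supp.ncard : ℝ) ≤ (1 - α) * (Nat.card V)

/-- `Z` is an in-class separator of `G` for the class `𝒢`: for every subset `X` of the connected
components of `G − Z`, the subgraph induced by `Z` together with the union of the components in
`X` belongs to `𝒢`. -/
def IsInClassSep (𝒢 : ∀ V : Type, SimpleGraph V → Prop) {V : Type}
    (G : SimpleGraph V) (Z : Set V) : Prop :=
  ∀ X : Set ((G.induce (Zᶜ : Set V)).ConnectedComponent),
    𝒢 ↥(Z ∪ compUnion G Z X) (G.induce (Z ∪ compUnion G Z X))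

/-- Weights that are each at most half of an upper bound `n` on their total can be split into two
parts, each of total weight at most `2n/3`. -/
lemma exists_finset_balanced_split {ι : Type*} [Fintype ι] (w : ι → ℕ) (n : ℕ)
    (hw : ∀ i, 2 * w i ≤ n) (htot : ∑ i, w i ≤ n) :
    ∃ X Y : Finset ι, (∀ i, i ∈ Y ↔ i ∉ X) ∧
      3 * ∑ i ∈ X, w i ≤ 2 * n ∧ 3 * ∑ i ∈ Y, w i ≤ 2 * n := by
  classical
  suffices h : ∃ X : Finset ι, 3 * ∑ i ∈ X, w i ≤ 2 * n ∧ 3 * ∑ i ∈ Xᶜ, w i ≤ 2 * n by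
    obtain ⟨X, hX, hXc⟩ := h
    exact ⟨X, Xᶜ, fun _ => Finset.mem_compl, hX, hXc⟩
  by_cases hbig : ∃ i, n ≤ 3 * w i
  · obtain ⟨i, hi⟩ := hbig
    have hsum := Finset.sum_add_sum_compl {i} w
    have := hw i
    refine ⟨{i}, ?_, ?_⟩ <;> rw [Finset.sum_singleton] at * <;> omega
  · push Not at hbig
    obtain ⟨X, hX, hmax⟩ := Finset.exists_max_image
      (Finset.univ.filter fun X : Finset ι => 3 * ∑ i ∈ X, w i ≤ 2 * n) (fun X => ∑ i ∈ X, w i)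
      ⟨∅, by simp⟩
    simp only [Finset.mem_filter, Finset.mem_univ, true_and] at hX hmax
    refine ⟨X, hX, ?_⟩
    by_contra! hlt
    have hsum := Finset.sum_add_sum_compl X w
    obtain ⟨i, hiX, hi⟩ : ∃ i ∈ Xᶜ, w i ≠ 0 := by
      by_contra! h0
      rw [Finset.sum_eq_zero h0] at hlt
      omega
    have hins := Finset.sum_insert (f := w) (Finset.mem_compl.1 hiX)
    have h1 := hbig i
    have h2 := hmax (insert i X) (by omega)
    omega

lemma ncard_compUnion_le {V : Type} [Finite V] (G : SimpleGraph V) (Z : Set V)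
    (X : Finset ((G.induce (Zᶜ : Set V)).ConnectedComponent)) :
    (compUnion G Z (X : Set _)).ncard ≤ ∑ C ∈ X, C.supp.ncard := by
  have hsub : compUnion G Z (X : Set _) ⊆ ⋃ C ∈ X, Subtype.val '' C.supp := by
    rintro v ⟨h, hv⟩
    simp only [Set.mem_iUnion]
    exact ⟨_, hv, ⟨v, h⟩, rfl, rfl⟩
  calc (compUnion G Z (X : Set _)).ncard
      ≤ (⋃ C ∈ X, Subtype.val '' C.supp).ncard := Set.ncard_le_ncard hsub (Set.toFinite _)
    _ ≤ ∑ C ∈ X, (Subtype.val '' C.supp).ncard := Finset.set_ncard_biUnion_le _ _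
    _ = ∑ C ∈ X, C.supp.ncard :=
        Finset.sum_congr rfl fun C _ => Set.ncard_image_of_injective _ Subtype.val_injective

lemma sum_ncard_supp {V : Type} [Finite V] (G : SimpleGraph V) [Fintype G.ConnectedComponent] :
    ∑ C : G.ConnectedComponent, C.supp.ncard = Nat.card V := by
  classical
  have := Fintype.ofFinite V
  rw [Nat.card_eq_fintype_card, ← Finset.card_univ,
    Finset.card_eq_sum_card_fiberwise (f := G.connectedComponentMk) (t := Finset.univ) (by simp)]
  refine Finset.sum_congr rfl fun C _ => ?_
  rw [← Set.ncard_coe_finset]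
  congr 1
  ext v
  simp

lemma card_le_three_mul_ncard_union_compUnion {V : Type} [Finite V] (G : SimpleGraph V) (Z : Set V)
    {X Y : Finset ((G.induce (Zᶜ : Set V)).ConnectedComponent)} (hXY : ∀ C, C ∈ X ∨ C ∈ Y)
    (hY : 3 * ∑ C ∈ Y, C.supp.ncard ≤ 2 * Nat.card V) :
    Nat.card V ≤ 3 * (Z ∪ compUnion G Z (X : Set _)).ncard := by
  have hcov : (Z ∪ compUnion G Z (X : Set _)) ∪ compUnion G Z (Y : Set _) = Set.univ := by
    ext v
    by_cases hv : v ∈ Z <;> simp [compUnion, hv, hXY]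
  have h1 := Set.ncard_union_le (Z ∪ compUnion G Z (X : Set _)) (compUnion G Z (Y : Set _))
  rw [hcov, Set.ncard_univ] at h1
  have h2 := ncard_compUnion_le G Z Y
  omega

/-- A balanced in-class separator splits the graph into two overlapping members of the class, each
containing at least a third of the vertices. -/
lemma IsInClassSep.exists_split {𝒢 : ∀ V : Type, SimpleGraph V → Prop} {V : Type} [Finite V]
    {G : SimpleGraph V} {Z : Set V} (hZ : IsInClassSep 𝒢 G Z) (hbal : IsBalSep G (1/2 : ℝ) Z) :
    ∃ A B : Set V, A ∪ B = Set.univ ∧ A ∩ B = Z ∧ Nat.card V ≤ 3 * A.ncard ∧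
      Nat.card V ≤ 3 * B.ncard ∧ 𝒢 A (G.induce A) ∧ 𝒢 B (G.induce B) := by
  have := Fintype.ofFinite ((G.induce (Zᶜ : Set V)).ConnectedComponent)
  have hhalf : ∀ C : (G.induce (Zᶜ : Set V)).ConnectedComponent,
      2 * C.supp.ncard ≤ Nat.card V := by
    intro C
    have h : (2 * C.supp.ncard : ℝ) ≤ Nat.card V := by linarith [hbal C]
    exact_mod_cast h
  have htot : ∑ C : (G.induce (Zᶜ : Set V)).ConnectedComponent, C.supp.ncard ≤ Nat.card V := by
    rw [sum_ncard_supp]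
    exact Nat.card_le_card_of_injective _ Subtype.val_injective
  obtain ⟨X, Y, hXY, hX, hY⟩ := exists_finset_balanced_split _ _ hhalf htot
  have hA : Nat.card V ≤ 3 * (Z ∪ compUnion G Z (X : Set _)).ncard :=
    card_le_three_mul_ncard_union_compUnion G Z (fun C => by rw [hXY]; exact em _) hY
  have hB : Nat.card V ≤ 3 * (Z ∪ compUnion G Z (Y : Set _)).ncard :=
    card_le_three_mul_ncard_union_compUnion G Z (fun C => by rw [hXY]; exact (em _).symm) hX
  have hunion : (Z ∪ compUnion G Z (X : Set _)) ∪ (Z ∪ compUnion G Z (Y : Set _)) = Set.univ := by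
    ext v
    by_cases hv : v ∈ Z <;> simp [compUnion, hv, hXY, em]
  have hinter : (Z ∪ compUnion G Z (X : Set _)) ∩ (Z ∪ compUnion G Z (Y : Set _)) = Z := by
    ext v
    by_cases hv : v ∈ Z <;> simp +contextual [compUnion, hv, hXY]
  exact ⟨_, _, hunion, hinter, hA, hB, hZ _, hZ _⟩

/-- Superadditivity of the square root absorbs the cost of one splitting step. -/
lemma division_cost_step {ρ r n p q z : ℝ} (hρ : 0 < ρ) (hr : 256 * ρ ^ 2 < r)
    (hrn : r < n) (hz : z ≤ ρ * √n) (hpq : p + q = n + z) (hz0 : 0 ≤ z)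
    (hp : n ≤ 3 * p) (hq : n ≤ 3 * q) :
    (16 * ρ * p / √r - 8 * ρ * √p) + (16 * ρ * q / √r - 8 * ρ * √q) + z ≤
      16 * ρ * n / √r - 8 * ρ * √n := by
  have hr0 : 0 < r := lt_of_le_of_lt (by positivity) hr
  have ht : 16 * ρ ≤ √r := Real.le_sqrt_of_sq_le (by nlinarith)
  have ht0 : 0 < √r := Real.sqrt_pos.2 hr0
  have hu := Real.sq_sqrt (show 0 ≤ p by linarith)
  have hv := Real.sq_sqrt (show 0 ≤ q by linarith)
  have hw := Real.sq_sqrt (show 0 ≤ n by linarith)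
  have hu0 := Real.sqrt_nonneg p
  have hv0 := Real.sqrt_nonneg q
  have hw0 := Real.sqrt_nonneg n
  have huv : n ≤ 3 * (√p * √q) := by
    refine (sq_le_sq₀ (by linarith) (by positivity)).1 ?_
    rw [show (3 * (√p * √q)) ^ 2 = (3 * √p ^ 2) * (3 * √q ^ 2) by ring, hu, hv, sq]
    exact mul_le_mul hp hq (by linarith) (by linarith)
  have hsum : 5 / 4 * √n ≤ √p + √q :=
    (sq_le_sq₀ (by positivity) (by positivity)).1 (by nlinarith)
  have hzt : 16 * ρ * z / √r ≤ z := by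
    rw [div_le_iff₀ ht0]
    nlinarith
  have hsplit : 16 * ρ * p / √r + 16 * ρ * q / √r = 16 * ρ * n / √r + 16 * ρ * z / √r := by
    rw [← add_div, ← add_div, ← mul_add, ← mul_add, hpq]
  nlinarith [mul_le_mul_of_nonneg_left hsum hρ.le]

/-- Repeated splitting of a vertex set `S` until all parts have at most `r` vertices. -/
lemma exists_division {ρ : ℝ} (hρ : 0 < ρ) {𝒢 : ∀ V : Type, SimpleGraph V → Prop}
    (hiso : ∀ (V W : Type) (G : SimpleGraph V) (H : SimpleGraph W),
      Nonempty (G ≃g H) → 𝒢 V G → 𝒢 W H)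
    (hsep : ∀ (V : Type) (G : SimpleGraph V), 𝒢 V G →
      ∃ Z : Set V, IsBalSep G (1/2 : ℝ) Z ∧ (Z.ncard : ℝ) ≤ ρ * √(Nat.card V) ∧
        IsInClassSep 𝒢 G Z)
    {V : Type} [Finite V] (G : SimpleGraph V) {r : ℕ} (hr : 256 * ρ ^ 2 < r)
    (S : Set V) (hS : 𝒢 S (G.induce S)) (hrS : r ≤ 3 * S.ncard) :
    ∃ Ps : Finset (Set V),
      (∀ v ∈ S, ∃ P ∈ Ps, v ∈ P) ∧ (∀ P ∈ Ps, P ⊆ S) ∧ (∀ P ∈ Ps, P.ncard ≤ r) ∧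
      (∀ P ∈ Ps, r ≤ 3 * P.ncard) ∧
      ((∑ P ∈ Ps, P.ncard : ℕ) : ℝ) ≤
        S.ncard + (16 * ρ * S.ncard / √r - 8 * ρ * √S.ncard) ∧
      ({v : V | ∃ P₁ ∈ Ps, ∃ P₂ ∈ Ps, P₁ ≠ P₂ ∧ v ∈ P₁ ∧ v ∈ P₂}.ncard : ℝ) ≤
        16 * ρ * S.ncard / √r - 8 * ρ * √S.ncard ∧
      ∀ P ∈ Ps, 𝒢 P (G.induce P) := by
  classical
  have hr0 : (0 : ℝ) < r := lt_of_le_of_lt (by positivity) hr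
  induction hm : S.ncard using Nat.strong_induction_on generalizing S with
  | _ m ih =>
  subst hm
  rcases le_or_gt S.ncard r with hle | hgt
  · have hcost : 0 ≤ 16 * ρ * S.ncard / √r - 8 * ρ * √S.ncard := by
      have h1 : (r : ℝ) ≤ 3 * S.ncard := by exact_mod_cast hrS
      have h2 : √r ≤ 2 * √S.ncard := by
        rw [Real.sqrt_le_left (by positivity), mul_pow, Real.sq_sqrt (by positivity)]
        linarith
      rw [sub_nonneg, le_div_iff₀ (Real.sqrt_pos.2 hr0)]
      have h3 := Real.sq_sqrt (Nat.cast_nonneg (α := ℝ) S.ncard)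
      have h4 := mul_le_mul_of_nonneg_left h2
        (show 0 ≤ 8 * ρ * √S.ncard by positivity)
      nlinarith
    refine ⟨{S}, by simp, by simp, by simpa using hle, by simpa using hrS, ?_, ?_, by simpa⟩
    · simpa using hcost
    · have hempty : {v : V | ∃ P₁ ∈ ({S} : Finset (Set V)), ∃ P₂ ∈ ({S} : Finset (Set V)),
          P₁ ≠ P₂ ∧ v ∈ P₁ ∧ v ∈ P₂} = ∅ := by
        ext v
        simp
      rw [hempty]
      simpa using hcost
  · obtain ⟨Z, hbal, hZcard, hZ⟩ := hsep S (G.induce S) hS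
    obtain ⟨A', B', hAB, hABZ, hA, hB, hGA, hGB⟩ := hZ.exists_split hbal
    have hval : Function.Injective (Subtype.val : S → V) := Subtype.val_injective
    have hind : ∀ T : Set S, 𝒢 T ((G.induce S).induce T) →
        𝒢 (Subtype.val '' T : Set V) (G.induce (Subtype.val '' T)) := fun T hT =>
      hiso _ _ _ _ ⟨⟨Equiv.Set.image _ T hval, Iff.rfl⟩⟩ hT
    rw [Nat.card_coe_set_eq] at hA hB hZcard
    replace hGA := hind _ hGA
    replace hGB := hind _ hGB
    have hcard := Set.ncard_union_add_ncard_inter A' B'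
    rw [hAB, hABZ, Set.ncard_univ, Nat.card_coe_set_eq] at hcard
    rw [← Set.ncard_image_of_injective A' hval] at hA hcard
    rw [← Set.ncard_image_of_injective B' hval] at hB hcard
    rw [← Set.ncard_image_of_injective Z hval] at hZcard hcard
    have hunion : Subtype.val '' A' ∪ Subtype.val '' B' = S := by
      rw [← Set.image_union, hAB, Set.image_univ, Subtype.range_coe]
    have hinter : Subtype.val '' A' ∩ Subtype.val '' B' = Subtype.val '' Z := by
      rw [← Set.image_inter hval, hABZ]
    generalize Subtype.val '' A' = A at *
    generalize Subtype.val '' B' = B at *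
    generalize Subtype.val '' Z = Y at *
    have hgt' : (r : ℝ) < S.ncard := by exact_mod_cast hgt
    have hYlt : 3 * Y.ncard < S.ncard := by
      have h1 : 16 * ρ ≤ √S.ncard := Real.le_sqrt_of_sq_le (by nlinarith)
      have h2 := Real.sq_sqrt (Nat.cast_nonneg (α := ℝ) S.ncard)
      have h3 : 0 < √(S.ncard : ℝ) := Real.sqrt_pos.2 (by linarith)
      have h4 : (3 * Y.ncard : ℝ) < S.ncard := by nlinarith
      exact_mod_cast h4
    have hstep := division_cost_step (p := A.ncard) (q := B.ncard) (z := Y.ncard) hρ hr hgt'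
      hZcard (by exact_mod_cast hcard.symm) (by positivity) (by exact_mod_cast hA)
      (by exact_mod_cast hB)
    have hcard' : (A.ncard + B.ncard : ℝ) = S.ncard + Y.ncard := by exact_mod_cast hcard.symm
    obtain ⟨Pa, ha1, ha2, ha3, ha4, ha5, ha6, ha7⟩ := ih _ (by omega) A hGA (by omega) rfl
    obtain ⟨Pb, hb1, hb2, hb3, hb4, hb5, hb6, hb7⟩ := ih _ (by omega) B hGB (by omega) rfl
    refine ⟨Pa ∪ Pb, ?_, ?_, ?_, ?_, ?_, ?_, ?_⟩
    · intro v hv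
      rw [← hunion] at hv
      rcases hv with hv | hv
      · obtain ⟨P, hP, hvP⟩ := ha1 v hv
        exact ⟨P, Finset.mem_union_left _ hP, hvP⟩
      · obtain ⟨P, hP, hvP⟩ := hb1 v hv
        exact ⟨P, Finset.mem_union_right _ hP, hvP⟩
    · rw [← hunion]
      exact fun P hP => (Finset.mem_union.1 hP).elim
        (fun h => (ha2 P h).trans Set.subset_union_left)
        (fun h => (hb2 P h).trans Set.subset_union_right)
    · exact fun P hP => (Finset.mem_union.1 hP).elim (ha3 P) (hb3 P)
    · exact fun P hP => (Finset.mem_union.1 hP).elim (ha4 P) (hb4 P)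
    · have h1 : ∑ P ∈ Pa ∪ Pb, P.ncard ≤ ∑ P ∈ Pa, P.ncard + ∑ P ∈ Pb, P.ncard := by
        rw [← Finset.sum_union_inter]
        exact Nat.le_add_right _ _
      have h2 : ((∑ P ∈ Pa ∪ Pb, P.ncard : ℕ) : ℝ) ≤
          (∑ P ∈ Pa, P.ncard : ℕ) + (∑ P ∈ Pb, P.ncard : ℕ) := by exact_mod_cast h1
      linarith
    · set Da := {v : V | ∃ P₁ ∈ Pa, ∃ P₂ ∈ Pa, P₁ ≠ P₂ ∧ v ∈ P₁ ∧ v ∈ P₂}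
      set Db := {v : V | ∃ P₁ ∈ Pb, ∃ P₂ ∈ Pb, P₁ ≠ P₂ ∧ v ∈ P₁ ∧ v ∈ P₂}
      have hsub : {v : V | ∃ P₁ ∈ Pa ∪ Pb, ∃ P₂ ∈ Pa ∪ Pb, P₁ ≠ P₂ ∧ v ∈ P₁ ∧ v ∈ P₂} ⊆
          Da ∪ Db ∪ Y := by
        rintro v ⟨P, hP, Q, hQ, hne, hvP, hvQ⟩
        rw [← hinter]
        rcases Finset.mem_union.1 hP with hP | hP <;> rcases Finset.mem_union.1 hQ with hQ | hQ
        · exact .inl (.inl ⟨P, hP, Q, hQ, hne, hvP, hvQ⟩)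
        · exact .inr ⟨ha2 P hP hvP, hb2 Q hQ hvQ⟩
        · exact .inr ⟨ha2 Q hQ hvQ, hb2 P hP hvP⟩
        · exact .inl (.inr ⟨P, hP, Q, hQ, hne, hvP, hvQ⟩)
      have h1 := Set.ncard_le_ncard hsub (Set.toFinite _)
      have h2 := Set.ncard_union_le (Da ∪ Db) Y
      have h3 := Set.ncard_union_le Da Db
      have h4 := h1.trans (h2.trans (Nat.add_le_add_right h3 _))
      have h5 := (Nat.cast_le (α := ℝ)).2 h4
      push_cast at h5
      linarith
    · exact fun P hP => (Finset.mem_union.1 hP).elim (ha7 P) (hb7 P)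

/-- If every `n`-vertex graph in an isomorphism-closed class `𝒢` of finite
connected graphs admits a `1/2`-balanced in-class separator of size `sep(n) ≤ ρ·√n`, then there
are constants `s, K` depending only on `ρ` such that every `n`-vertex graph `G ∈ 𝒢` has, for
every `s < r < n`, a weak `r`-division all of whose groups induce graphs in `𝒢`. -/
theorem stmt_9 (ρ : ℝ) (hρ : 0 < ρ) :
    ∃ (s : ℕ) (K : ℝ), 0 < K ∧
      ∀ (𝒢 : ∀ V : Type, SimpleGraph V → Prop),
        (∀ (V W : Type) (G : SimpleGraph V) (H : SimpleGraph W),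
          Nonempty (G ≃g H) → 𝒢 V G → 𝒢 W H) →
        (∀ (V : Type) (G : SimpleGraph V), 𝒢 V G → Finite V ∧ G.Connected) →
        ∀ (sep : ℕ → ℕ), Monotone sep → (∀ n : ℕ, (sep n : ℝ) ≤ ρ * Real.sqrt n) →
        (∀ (V : Type) (G : SimpleGraph V), 𝒢 V G →
          ∃ Z : Set V, IsBalSep G (1/2 : ℝ) Z ∧ Z.ncard ≤ sep (Nat.card V) ∧
            IsInClassSep 𝒢 G Z) →
        ∀ (V : Type) (G : SimpleGraph V), 𝒢 V G → ∀ r : ℕ, s < r → r < Nat.card V →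
          ∃ Ps : Finset (Set V),
            (∀ v : V, ∃ P ∈ Ps, v ∈ P) ∧
            (∀ P ∈ Ps, P.ncard ≤ r) ∧
            ((Ps.card : ℝ) ≤ K * (Nat.card V) / r) ∧
            (({v : V | ∃ P₁ ∈ Ps, ∃ P₂ ∈ Ps, P₁ ≠ P₂ ∧ v ∈ P₁ ∧ v ∈ P₂}.ncard : ℝ)
              ≤ K * (Nat.card V) / Real.sqrt r) ∧
            (∀ P ∈ Ps, 𝒢 ↥P (G.induce P)) := by
  refine ⟨⌈256 * ρ ^ 2⌉₊ + 1, 3 * (1 + 16 * ρ), by positivity, ?_⟩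
  intro 𝒢 hiso hfin sep _ hsep hZ V G hG r hr hrn
  have := (hfin V G hG).1
  have hr1 : (1 : ℝ) ≤ r := by exact_mod_cast (by omega : 1 ≤ r)
  have hr' : 256 * ρ ^ 2 < r :=
    (Nat.le_ceil _).trans_lt (by exact_mod_cast (by omega : ⌈256 * ρ ^ 2⌉₊ < r))
  obtain ⟨Ps, h1, -, h3, h4, h5, h6, h7⟩ := exists_division hρ hiso
    (fun V G hG => by
      obtain ⟨Z, hb, hc, hi⟩ := hZ V G hG
      exact ⟨Z, hb, (Nat.cast_le.2 hc).trans (hsep _), hi⟩)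
    G hr' Set.univ (hiso _ _ _ _ ⟨(induceUnivIso G).symm⟩ hG)
    (by rw [Set.ncard_univ]; omega)
  rw [Set.ncard_univ] at h5 h6
  have hs1 : 1 ≤ √(r : ℝ) := Real.one_le_sqrt.2 hr1
  have hs0 : 0 ≤ 8 * ρ * √(Nat.card V : ℝ) := by positivity
  refine ⟨Ps, fun v => h1 v (Set.mem_univ v), h3, ?_, ?_, h7⟩
  · have hcount : Ps.card * r ≤ 3 * ∑ P ∈ Ps, P.ncard := by
      rw [Finset.mul_sum, ← smul_eq_mul]
      exact Finset.card_nsmul_le_sum _ _ _ h4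
    have hcount' : (Ps.card * r : ℝ) ≤ 3 * (∑ P ∈ Ps, P.ncard : ℕ) := by exact_mod_cast hcount
    have hdiv : 16 * ρ * (Nat.card V : ℝ) / √r ≤ 16 * ρ * Nat.card V :=
      div_le_self (by positivity) hs1
    rw [le_div_iff₀ (by linarith)]
    linarith
  · have hle : 16 * ρ * (Nat.card V : ℝ) / √r ≤ 3 * (1 + 16 * ρ) * Nat.card V / √r := by
      refine div_le_div_of_nonneg_right
        (mul_le_mul_of_nonneg_right (by linarith) (Nat.cast_nonneg _)) (by linarith)
    linarith
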